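/- For every commutative monoid M, there exists a commutative ring R such that Spec(M) is homeomorphic to the prime spectrum of R (with its Zariski topology); that is, the underlying space of the Kato spectrum of a commutative monoid is always a spectral space. -/

import Mathlib

open Set Topology TopologicalSpace

universe u v

/-- An ideal of a commutative monoid: closed under multiplication by arbitrary elements. -/
def IsMonoidIdeal {M : Type*} [CommMonoid M] (I : Set M) : Prop :=
  ∀ x ∈ I, ∀ m : M, x * m ∈ I

/-- A prime ideal of a commutative monoid: an ideal whose complement is a submonoid
(contains `1` and is closed under multiplication). -/
def IsMonoidPrime {M : Type*} [CommMonoid M] (p : Set M) : Prop :=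
  IsMonoidIdeal p ∧ (1 : M) ∉ p ∧ ∀ x y : M, x ∉ p → y ∉ p → x * y ∉ p

/-- The Kato spectrum of a commutative monoid: the set of its prime ideals. -/
def KatoSpec (M : Type*) [CommMonoid M] : Type _ :=
  {p : Set M // IsMonoidPrime p}

/-- The basic open set `D(f) = {p : f ∉ p}`. -/
def KatoD {M : Type*} [CommMonoid M] (f : M) : Set (KatoSpec M) :=
  {p | f ∉ p.1}

/-- The topology on the Kato spectrum, generated by the sets `D(f)`. -/
instance KatoSpec.instTopologicalSpace (M : Type*) [CommMonoid M] :
    TopologicalSpace (KatoSpec M) :=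
  TopologicalSpace.generateFrom (Set.range fun f : M => KatoD f)

/-- A blob: the intersection of all open sets containing some point `a`. -/
def IsBlob {X : Type*} [TopologicalSpace X] (A : Set X) : Prop :=
  ∃ a : X, A = ⋂₀ {U : Set X | IsOpen U ∧ a ∈ U}

/-- Condition (*): whenever an intersection of a family of open blobs is contained in an
open set `V`, some finite subfamily already has intersection contained in `V`. -/
def CondStar (X : Type*) [TopologicalSpace X] : Prop :=
  ∀ S : Set (Set X), (∀ U ∈ S, IsOpen U ∧ IsBlob U) →
    ∀ V : Set X, IsOpen V → ⋂₀ S ⊆ V →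
      ∃ T : Finset (Set X), ↑T ⊆ S ∧ ⋂₀ (T : Set (Set X)) ⊆ V

/-- A monoidal base: a base of open sets containing the whole space and closed under
finite (binary) intersections. -/
structure IsMonoidalBase {X : Type*} [TopologicalSpace X] (B : Set (Set X)) : Prop where
  open_mem : ∀ U ∈ B, IsOpen U
  is_base : ∀ V : Set X, IsOpen V → ∀ x ∈ V, ∃ U ∈ B, x ∈ U ∧ U ⊆ V
  univ_mem : Set.univ ∈ B
  inter_mem : ∀ U ∈ B, ∀ V ∈ B, U ∩ V ∈ B

/-- `(X, B)` is an 𝕄-complete join semilattice with respect to the explicit data of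
a partial order `le` and a supremum operator `s`. -/
def IsMCJSWith {X : Type*} (B : Set (Set X)) (le : X → X → Prop) (s : Set X → X) : Prop :=
  (∀ x, le x x) ∧
  (∀ x y z, le x y → le y z → le x z) ∧
  (∀ x y, le x y → le y x → x = y) ∧
  (∀ A : Set X, (∀ a ∈ A, le a (s A)) ∧ ∀ b : X, (∀ a ∈ A, le a b) → le (s A) b) ∧
  (∀ A : Set X, ∀ U ∈ B, (A ⊆ U ↔ s A ∈ U))

/-- `(X, B)` is an 𝕄-complete join semilattice: there is a partial order on `X` in which
every subset has a least upper bound, such that for `U ∈ B`, `A ⊆ U ↔ sup A ∈ U`. -/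
def MCJS {X : Type*} (B : Set (Set X)) : Prop :=
  ∃ (le : X → X → Prop) (s : Set X → X), IsMCJSWith B le s

/-- An isomorphism of spaces-with-monoidal-bases: a bijection such that both it and its
inverse pull back base elements to base elements. -/
def MIso {X Y : Type*} (B : Set (Set X)) (C : Set (Set Y)) : Prop :=
  ∃ f : X → Y, Function.Bijective f ∧ (∀ V ∈ C, f ⁻¹' V ∈ B) ∧ (∀ U ∈ B, f '' U ∈ C)

/-- The topology on the power set `𝒫(X)` generated by the sets `𝒫(U) = {A | A ⊆ U}`, `U ∈ B`. -/
def ExpTop {X : Type*} (B : Set (Set X)) : TopologicalSpace (Set X) :=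
  TopologicalSpace.generateFrom {s : Set (Set X) | ∃ U ∈ B, s = {A : Set X | A ⊆ U}}

/-- The equivalence relation `A ∼ A'` iff `A` and `A'` belong to the same open sets of `𝒫(X)`. -/
def ExpSetoid {X : Type*} (B : Set (Set X)) : Setoid (Set X) where
  r A A' := ∀ s : Set (Set X), (ExpTop B).IsOpen s → (A ∈ s ↔ A' ∈ s)
  iseqv := ⟨fun _ _ _ => Iff.rfl, fun h s hs => (h s hs).symm,
    fun h h' s hs => (h s hs).trans (h' s hs)⟩

/-- The exponential `E(X,B)`: the quotient of `𝒫(X)` identifying sets lying in the same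
open sets. -/
def ExpSpace {X : Type*} (B : Set (Set X)) : Type _ :=
  Quotient (ExpSetoid B)

/-- The class `[A]` of a subset `A ⊆ X` in `E(X,B)`. -/
def expMk {X : Type*} (B : Set (Set X)) (A : Set X) : ExpSpace B :=
  Quotient.mk (ExpSetoid B) A

/-- The quotient topology on `E(X,B)`. -/
instance ExpSpace.instTopologicalSpace {X : Type*} (B : Set (Set X)) :
    TopologicalSpace (ExpSpace B) :=
  (ExpTop B).coinduced (expMk B)

/-- The basic subset `Ũ = {[A] : A ⊆ U}` of `E(X,B)`. -/
def expBasic {X : Type*} (B : Set (Set X)) (U : Set X) : Set (ExpSpace B) :=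
  {q | ∃ A : Set X, q = expMk B A ∧ A ⊆ U}

/-- The monoidal base `B̃ = {Ũ : U ∈ B}` of `E(X,B)`. -/
def expBase {X : Type*} (B : Set (Set X)) : Set (Set (ExpSpace B)) :=
  {s | ∃ U ∈ B, s = expBasic B U}

/-- The natural map `i : X → E(X,B)`, `x ↦ [{x}]`. -/
def expI {X : Type*} (B : Set (Set X)) (x : X) : ExpSpace B :=
  expMk B {x}

/-- The canonical supremum in `E(X,B)`: the class of the union of all representatives. -/
def expSup {X : Type*} (B : Set (Set X)) (S : Set (ExpSpace B)) : ExpSpace B :=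
  expMk B (⋃₀ {A : Set X | expMk B A ∈ S})

/-- The specialization order: `a ≤ b` iff `b ∈ closure {a}`. -/
def specLE {Y : Type*} [TopologicalSpace Y] (a b : Y) : Prop :=
  b ∈ closure {a}

/-- The commutative monoid `(B, ∩)` attached to a monoidal base `B`, with identity `X`. -/
def baseMonoid {X : Type*} [TopologicalSpace X] {B : Set (Set X)} (hB : IsMonoidalBase B) :
    CommMonoid ↥B where
  mul U V := ⟨U.1 ∩ V.1, hB.inter_mem _ U.2 _ V.2⟩
  one := ⟨Set.univ, hB.univ_mem⟩
  mul_assoc U V W := Subtype.ext (Set.inter_assoc _ _ _)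
  mul_comm U V := Subtype.ext (Set.inter_comm _ _)
  one_mul U := Subtype.ext (Set.univ_inter _)
  mul_one U := Subtype.ext (Set.inter_univ _)


section Degeneration

open Polynomial PowerSeries

variable {M : Type u}

/-- The field of rational functions over `ℚ` in variables indexed by `M`. -/
abbrev KatoField (M : Type u) : Type u := FractionRing (MvPolynomial M ℚ)

/-- The variable of `KatoField M` attached to `m`. -/
noncomputable def katoVar (m : M) : KatoField M :=
  algebraMap (MvPolynomial M ℚ) (KatoField M) (MvPolynomial.X m)

theorem katoVar_ne_zero (m : M) : katoVar m ≠ 0 :=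
  (map_ne_zero_iff _ (IsFractionRing.injective _ _)).2 (MvPolynomial.X_ne_zero m)

open Classical in
/-- Multiply the variables indexed by `s` by a new variable `T`. -/
noncomputable def scalePoly (s : Set M) : MvPolynomial M ℚ →ₐ[ℚ] (KatoField M)[X] :=
  MvPolynomial.aeval fun m => Polynomial.C (katoVar m) * if m ∈ s then Polynomial.X else 1

theorem eval_one_scalePoly (s : Set M) (a : MvPolynomial M ℚ) :
    (scalePoly s a).eval 1 = algebraMap _ (KatoField M) a := by
  have : ((Polynomial.aeval (1 : KatoField M)).restrictScalars ℚ).comp (scalePoly s) =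
      IsScalarTower.toAlgHom ℚ (MvPolynomial M ℚ) (KatoField M) := by
    apply MvPolynomial.algHom_ext
    intro m
    by_cases h : m ∈ s <;> simp [scalePoly, h, katoVar]
  simpa [Polynomial.aeval_def] using DFunLike.congr_fun this a

theorem scalePoly_injective (s : Set M) : Function.Injective (scalePoly s) := fun a b h =>
  IsFractionRing.injective (MvPolynomial M ℚ) (KatoField M) <| by
    rw [← eval_one_scalePoly s, h, eval_one_scalePoly]

theorem natDegree_scalePoly_le (s : Set M) (a : MvPolynomial M ℚ) :
    (scalePoly s a).natDegree ≤ a.totalDegree := by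
  rw [scalePoly, MvPolynomial.aeval_def, MvPolynomial.eval₂]
  refine (Polynomial.natDegree_sum_le _ _).trans (Finset.sup_le fun d hd => ?_)
  simp only [Function.comp_apply]
  rw [IsScalarTower.algebraMap_apply ℚ (KatoField M) (KatoField M)[X],
    Polynomial.algebraMap_eq]
  refine (Polynomial.natDegree_C_mul_le _ _).trans ((Polynomial.natDegree_prod_le _ _).trans ?_)
  refine le_trans (Finset.sum_le_sum fun m _ => ?_) (MvPolynomial.le_totalDegree hd)
  refine Polynomial.natDegree_pow_le.trans (mul_le_of_le_one_right' ?_)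
  refine (Polynomial.natDegree_C_mul_le _ _).trans ?_
  split_ifs <;> simp

/-- `scalePoly` with values in power series. -/
noncomputable def scaleSeries (s : Set M) : MvPolynomial M ℚ →+* (KatoField M)⟦X⟧ :=
  Polynomial.coeToPowerSeries.ringHom.comp (scalePoly s : MvPolynomial M ℚ →+* (KatoField M)[X])

theorem scaleSeries_apply (s : Set M) (a : MvPolynomial M ℚ) :
    scaleSeries s a = (scalePoly s a : (KatoField M)⟦X⟧) := rfl

theorem scaleSeries_injective (s : Set M) : Function.Injective (scaleSeries s) :=
  (Polynomial.coe_injective _).comp (scalePoly_injective s)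

theorem scaleSeries_dvd (s : Set M) {a : MvPolynomial M ℚ} (ha : a ≠ 0) :
    scaleSeries s a ∣ PowerSeries.X ^ a.totalDegree := by
  have h0 : scaleSeries s a ≠ 0 := (map_ne_zero_iff _ (scaleSeries_injective s)).2 ha
  have hle : (scaleSeries s a).order.toNat ≤ a.totalDegree := by
    refine le_trans ?_ (natDegree_scalePoly_le s a)
    apply Polynomial.le_natDegree_of_ne_zero
    rw [← Polynomial.coeff_coe]
    exact PowerSeries.coeff_order h0
  have hu := PowerSeries.isUnit_divided_by_X_pow_order h0
  rw [← PowerSeries.X_pow_order_mul_divXPowOrder (f := scaleSeries s a), hu.mul_right_dvd]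
  exact pow_dvd_pow _ hle

/-- The extension of `scaleSeries` to fraction fields. -/
noncomputable def scale (s : Set M) : KatoField M →+* FractionRing (KatoField M)⟦X⟧ :=
  IsFractionRing.lift (g := (algebraMap _ _).comp (scaleSeries s))
    ((IsFractionRing.injective _ _).comp (scaleSeries_injective s))

theorem scale_algebraMap (s : Set M) (a : MvPolynomial M ℚ) :
    scale s (algebraMap _ _ a) = algebraMap _ _ (scaleSeries s a) :=
  IsFractionRing.lift_algebraMap _ a

/-- `b` is the limit of `a` as the variables indexed by `s` tend to zero uniformly. -/
def HasLimit (s : Set M) (a b : KatoField M) : Prop :=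
  ∃ p : (KatoField M)⟦X⟧, scale s a = algebraMap _ _ p ∧ PowerSeries.constantCoeff p = b

namespace HasLimit

variable {s : Set M} {a a' b b' : KatoField M}

theorem zero : HasLimit s 0 0 := ⟨0, by simp, by simp⟩

theorem one : HasLimit s 1 1 := ⟨1, by simp, by simp⟩

theorem add : HasLimit s a b → HasLimit s a' b' → HasLimit s (a + a') (b + b') := by
  rintro ⟨p, h, rfl⟩ ⟨q, h', rfl⟩
  exact ⟨p + q, by simp [h, h'], by simp⟩

theorem mul : HasLimit s a b → HasLimit s a' b' → HasLimit s (a * a') (b * b') := by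
  rintro ⟨p, h, rfl⟩ ⟨q, h', rfl⟩
  exact ⟨p * q, by simp [h, h'], by simp⟩

theorem neg : HasLimit s a b → HasLimit s (-a) (-b) := by
  rintro ⟨p, h, rfl⟩
  exact ⟨-p, by simp [h], by simp⟩

theorem eq_zero (h : HasLimit s 0 b) : b = 0 := by
  obtain ⟨p, hp, rfl⟩ := h
  rw [map_zero, eq_comm, map_eq_zero_iff _ (IsFractionRing.injective _ _)] at hp
  simp [hp]

theorem katoVar_of_mem {m : M} (hm : m ∈ s) : HasLimit s (katoVar m) 0 :=
  ⟨scaleSeries s (MvPolynomial.X m), scale_algebraMap _ _, by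
    simp [scaleSeries_apply, scalePoly, hm]⟩

theorem katoVar_of_notMem {m : M} (hm : m ∉ s) : HasLimit s (katoVar m) (katoVar m) :=
  ⟨scaleSeries s (MvPolynomial.X m), scale_algebraMap _ _, by
    simp [scaleSeries_apply, scalePoly, hm]⟩

end HasLimit

/-- The order of vanishing of a nonzero `a` along `s` is bounded independently of `s`. -/
theorem exists_forall_dvd_X_pow (a : KatoField M) (ha : a ≠ 0) :
    ∃ d : ℕ, ∀ (s : Set M) (p : (KatoField M)⟦X⟧), scale s a = algebraMap _ _ p →
      p ∣ PowerSeries.X ^ d := by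
  obtain ⟨x, y, hy, rfl⟩ := IsFractionRing.div_surjective (A := MvPolynomial M ℚ) a
  have hy0 := nonZeroDivisors.ne_zero hy
  have hx0 : x ≠ 0 := by
    rintro rfl
    simp at ha
  refine ⟨x.totalDegree, fun s p hp => (Dvd.intro (scaleSeries s y) ?_).trans
    (scaleSeries_dvd s hx0)⟩
  apply IsFractionRing.injective _ (FractionRing (KatoField M)⟦X⟧)
  have : algebraMap _ (FractionRing (KatoField M)⟦X⟧) (scaleSeries s y) ≠ 0 := by
    rw [map_ne_zero_iff _ (IsFractionRing.injective _ _)]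
    exact (map_ne_zero_iff _ (scaleSeries_injective s)).2 hy0
  rw [map_mul, ← hp, map_div₀, scale_algebraMap, scale_algebraMap, div_mul_cancel₀ _ this]

theorem HasLimit.pow_div {s : Set M} {a a' b b' : KatoField M} {d : ℕ}
    (ha : HasLimit s a a') (hb : HasLimit s b b') (h' : b' = 0 → a' = 0)
    (hd : b ≠ 0 → ∀ p : (KatoField M)⟦X⟧, scale s b = algebraMap _ _ p → p ∣ PowerSeries.X ^ d) :
    HasLimit s (a ^ (d + 1) / b) (a' ^ (d + 1) / b') := by
  by_cases hb0 : b = 0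
  · subst hb0
    rw [hb.eq_zero, div_zero, div_zero]
    exact HasLimit.zero
  obtain ⟨p, hp, rfl⟩ := ha
  obtain ⟨q, hq, rfl⟩ := hb
  have hq0 : algebraMap _ (FractionRing (KatoField M)⟦X⟧) q ≠ 0 := by
    rwa [← hq, _root_.map_ne_zero]
  by_cases hc : PowerSeries.constantCoeff q = 0
  · obtain ⟨w, hw⟩ := PowerSeries.X_dvd_iff.2 (h' hc)
    obtain ⟨u, hu⟩ := hd hb0 q hq
    refine ⟨PowerSeries.X * u * w ^ (d + 1), ?_, by simp [hc]⟩
    rw [map_div₀, map_pow, hp, hq, div_eq_iff hq0, ← map_pow, ← map_mul, hw, mul_pow, pow_succ,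
      hu]
    congr 1
    ring
  · refine ⟨p ^ (d + 1) * q⁻¹, ?_, by simp [div_eq_mul_inv]⟩
    rw [map_div₀, map_pow, hp, hq, div_eq_iff hq0, ← map_pow, ← map_mul, mul_assoc,
      PowerSeries.inv_mul_cancel _ hc, mul_one]

end Degeneration

section KatoRing

variable {M : Type u} [CommMonoid M]

theorem IsMonoidPrime.mem_of_dvd {p : Set M} (hp : IsMonoidPrime p) {x y : M} (h : x ∣ y)
    (hx : x ∈ p) : y ∈ p := by
  obtain ⟨m, rfl⟩ := h
  exact hp.1 x hx m

/-- The complement of a prime ideal, as a submonoid. -/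
def IsMonoidPrime.primeCompl {p : Set M} (hp : IsMonoidPrime p) : Submonoid M where
  carrier := pᶜ
  one_mem' := hp.2.1
  mul_mem' {x y} hx hy := hp.2.2 x y hx hy

/-- The largest prime ideal not containing `e`. -/
def KatoSpec.away (e : M) : KatoSpec M :=
  ⟨{m | ∀ n : ℕ, ¬ m ∣ e ^ n}, fun _ hx m n h => hx n ((Dvd.intro m rfl).trans h),
    fun h => h 0 (by simp), fun x y hx hy => by
      simp only [mem_ofPred_eq, not_forall, not_not] at hx hy ⊢
      obtain ⟨i, hi⟩ := hx
      obtain ⟨j, hj⟩ := hy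
      exact ⟨i + j, pow_add e i j ▸ mul_dvd_mul hi hj⟩⟩

theorem KatoSpec.notMem_of_dvd_pow {p : KatoSpec M} {e m : M} (he : e ∉ p.1) {n : ℕ}
    (h : m ∣ e ^ n) : m ∉ p.1 := fun hm =>
  pow_mem (S := p.2.primeCompl) he n (p.2.mem_of_dvd h hm)

theorem KatoSpec.subset_away {p : KatoSpec M} {e : M} (he : e ∉ p.1) : p.1 ⊆ (away e).1 :=
  fun _ hm _ h => notMem_of_dvd_pow he h hm

/-- `r` takes equal values at primes that agree on some fixed finite set. -/
def FinitelyDetermined {Y : Type*} (r : KatoSpec M → Y) : Prop :=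
  ∃ E : Finset M, ∀ p q : KatoSpec M, (∀ m ∈ E, m ∈ p.1 ↔ m ∈ q.1) → r p = r q

theorem FinitelyDetermined.comp₂ {Y Z W : Type*} {r : KatoSpec M → Y} {t : KatoSpec M → Z}
    (hr : FinitelyDetermined r) (ht : FinitelyDetermined t) (f : Y → Z → W) :
    FinitelyDetermined fun p => f (r p) (t p) := by
  classical
  obtain ⟨E, hE⟩ := hr
  obtain ⟨E', hE'⟩ := ht
  refine ⟨E ∪ E', fun p q h => ?_⟩
  simp only [Finset.mem_union] at h
  dsimp only
  rw [hE p q fun m hm => h m (.inl hm), hE' p q fun m hm => h m (.inr hm)]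

theorem FinitelyDetermined.const {Y : Type*} (c : Y) :
    FinitelyDetermined fun _ : KatoSpec M => c := ⟨∅, fun _ _ _ => rfl⟩

theorem FinitelyDetermined.comp {Y W : Type*} {r : KatoSpec M → Y}
    (hr : FinitelyDetermined r) (f : Y → W) : FinitelyDetermined fun p => f (r p) :=
  hr.comp₂ hr fun y _ => f y

theorem FinitelyDetermined.finite_range {Y : Type*} {r : KatoSpec M → Y}
    (hr : FinitelyDetermined r) : (range r).Finite := by
  classical
  obtain ⟨E, hE⟩ := hr
  let g : KatoSpec M → Finset M := fun p => E.filter (· ∈ p.1)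
  have hg : (range g).Finite := E.powerset.finite_toSet.subset <| by
    rintro _ ⟨p, rfl⟩
    exact Finset.mem_powerset.2 (Finset.filter_subset _ _)
  have hf : Function.FactorsThrough r g := fun p q h => hE p q fun m hm => by
    simpa [g, hm] using Finset.ext_iff.1 h m
  rcases isEmpty_or_nonempty Y with hY | hY
  · exact toFinite _
  · have := hg.image (Function.extend g r fun _ => hY.some)
    rwa [← range_comp, hf.extend_comp] at this

/-- A ring of functions on the Kato spectrum with values in `KatoField M`. -/
noncomputable def katoRing (M : Type u) [CommMonoid M] : Subring (KatoSpec M → KatoField M) where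
  carrier := {r | FinitelyDetermined r ∧ ∀ p q : KatoSpec M, p.1 ⊆ q.1 → HasLimit q.1 (r p) (r q)}
  zero_mem' := ⟨.const 0, fun _ _ _ => .zero⟩
  one_mem' := ⟨.const 1, fun _ _ _ => .one⟩
  add_mem' hr ht := ⟨hr.1.comp₂ ht.1 (· + ·), fun p q h => (hr.2 p q h).add (ht.2 p q h)⟩
  mul_mem' hr ht := ⟨hr.1.comp₂ ht.1 (· * ·), fun p q h => (hr.2 p q h).mul (ht.2 p q h)⟩
  neg_mem' hr := ⟨hr.1.comp (- ·), fun p q h => (hr.2 p q h).neg⟩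

namespace katoRing

open Classical in
/-- The function equal to the variable `katoVar m` on `KatoD m`, and to zero elsewhere. -/
noncomputable def var (m : M) : katoRing M :=
  ⟨fun p => if m ∈ p.1 then 0 else katoVar m,
    ⟨{m}, fun p q h => by simp [h m (by simp)]⟩, fun p q h => by
      by_cases hp : m ∈ p.1
      · simpa [hp, h hp] using HasLimit.zero
      · by_cases hq : m ∈ q.1
        · simpa [hp, hq] using HasLimit.katoVar_of_mem hq
        · simpa [hp, hq] using HasLimit.katoVar_of_notMem hq⟩

theorem var_apply_eq_zero {m : M} {p : KatoSpec M} : (var m).1 p = 0 ↔ m ∈ p.1 := by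
  simp [var, katoVar_ne_zero]

theorem sum_var_apply_ne_zero {E : Finset M} {e : M} (he : e ∈ E) {p : KatoSpec M}
    (hp : e ∉ p.1) : (∑ m ∈ E, var m).1 p ≠ 0 := by
  classical
  have : (∑ m ∈ E, var m).1 p = algebraMap (MvPolynomial M ℚ) (KatoField M)
      (∑ m ∈ E, if m ∈ p.1 then 0 else MvPolynomial.X m) := by
    simp [var, katoVar, apply_ite (algebraMap (MvPolynomial M ℚ) (KatoField M))]
  rw [this, map_ne_zero_iff _ (IsFractionRing.injective _ _)]
  intro h
  have h1 := congrArg (MvPolynomial.coeff (Finsupp.single e 1)) h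
  rw [MvPolynomial.coeff_sum, Finset.sum_eq_single e] at h1
  · simp [hp] at h1
  · intro m _ hm
    split_ifs
    · simp
    · simp [MvPolynomial.coeff_X, Finsupp.single_left_inj, hm]
  · exact fun h => absurd he h

/-- The nonvanishing locus of an element is a finite union of basic open sets. -/
theorem exists_support_eq (r : katoRing M) :
    ∃ E : Finset M, ∀ p : KatoSpec M, r.1 p ≠ 0 ↔ ∃ e ∈ E, e ∉ p.1 := by
  classical
  obtain ⟨r, ⟨E, hE⟩, hr⟩ := r
  let prodOf : Finset M → M := fun F => ∏ m ∈ F, m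
  have key : ∀ p, r p ≠ 0 → ∃ F ⊆ E, prodOf F ∉ p.1 ∧ r (KatoSpec.away (prodOf F)) ≠ 0 := by
    intro p hp
    have hmem : prodOf (E.filter (· ∉ p.1)) ∉ p.1 :=
      prod_mem (S := p.2.primeCompl) fun m hm => (Finset.mem_filter.1 hm).2
    refine ⟨E.filter (· ∉ p.1), Finset.filter_subset _ _, hmem, ?_⟩
    rwa [← hE p _ fun m hm => ⟨fun h => KatoSpec.subset_away hmem h, fun h => ?_⟩]
    by_contra hmp
    exact h 1 (by simpa using Finset.dvd_prod_of_mem _ (Finset.mem_filter.2 ⟨hm, hmp⟩))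
  refine ⟨(E.powerset.filter fun F => r (KatoSpec.away (prodOf F)) ≠ 0).image prodOf,
    fun p => ⟨fun hp => ?_, ?_⟩⟩
  · obtain ⟨F, hF, hFp, hF0⟩ := key p hp
    exact ⟨_, Finset.mem_image_of_mem _ (by simpa using ⟨hF, hF0⟩), hFp⟩
  · rintro ⟨e, he, hep⟩ hp
    obtain ⟨F, hF, rfl⟩ := Finset.mem_image.1 he
    have := hr p _ (KatoSpec.subset_away hep)
    rw [show r p = 0 from hp] at this
    exact (Finset.mem_filter.1 hF).2 this.eq_zero

/-- Containment of nonvanishing loci implies divisibility up to a power. -/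
theorem exists_dvd_pow {r t : katoRing M} (h : ∀ p, t.1 p = 0 → r.1 p = 0) :
    ∃ n : ℕ, t ∣ r ^ n := by
  obtain ⟨d, hd⟩ : ∃ d : ℕ, ∀ a ∈ range t.1, a ≠ 0 → ∀ (s : Set M) (p : PowerSeries (KatoField M)),
      scale s a = algebraMap _ _ p → p ∣ PowerSeries.X ^ d := by
    have (a : KatoField M) : ∃ d : ℕ, a ≠ 0 → ∀ (s : Set M) (p : PowerSeries (KatoField M)),
        scale s a = algebraMap _ _ p → p ∣ PowerSeries.X ^ d := by
      by_cases ha : a = 0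
      · exact ⟨0, fun h => absurd ha h⟩
      · exact (exists_forall_dvd_X_pow a ha).imp fun _ h _ => h
    choose f hf using this
    obtain ⟨d, hd⟩ := (t.2.1.finite_range.image f).bddAbove
    exact ⟨d, fun a ha h0 s p hp =>
      (hf a h0 s p hp).trans (pow_dvd_pow _ (hd (mem_image_of_mem f ha)))⟩
  refine ⟨d + 1, ⟨fun p => r.1 p ^ (d + 1) / t.1 p, r.2.1.comp₂ t.2.1 fun a b => a ^ (d + 1) / b,
    fun p q hpq => (r.2.2 p q hpq).pow_div (t.2.2 p q hpq) (h q)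
      fun h0 => hd _ (mem_range_self p) h0 q.1⟩, ?_⟩
  ext p
  by_cases hp : t.1 p = 0
  · simp [hp, h p hp]
  · simp [mul_div_cancel₀ _ hp]

/-- Evaluation at a point of the Kato spectrum. -/
noncomputable def evalAt (p : KatoSpec M) : katoRing M →+* KatoField M :=
  (Pi.evalRingHom _ p).comp (katoRing M).subtype

/-- The map from the Kato spectrum of `M` to the prime spectrum of `katoRing M`. -/
noncomputable def toSpec (p : KatoSpec M) : PrimeSpectrum (katoRing M) :=
  ⟨RingHom.ker (evalAt p), RingHom.ker_isPrime _⟩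

theorem mem_toSpec {p : KatoSpec M} {r : katoRing M} : r ∈ (toSpec p).asIdeal ↔ r.1 p = 0 :=
  Iff.rfl

theorem toSpec_injective : Function.Injective (toSpec (M := M)) := fun p q h => by
  apply Subtype.ext
  ext m
  rw [← var_apply_eq_zero, ← var_apply_eq_zero, ← mem_toSpec, h, mem_toSpec]

theorem mem_of_support_subset (P : PrimeSpectrum (katoRing M)) {r t : katoRing M}
    (ht : t ∈ P.asIdeal) (h : ∀ p, t.1 p = 0 → r.1 p = 0) : r ∈ P.asIdeal := by
  obtain ⟨n, hn⟩ := exists_dvd_pow h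
  exact P.isPrime.mem_of_pow_mem n (P.asIdeal.mem_of_dvd hn ht)

theorem isMonoidPrime_setOf_var_mem (P : PrimeSpectrum (katoRing M)) :
    IsMonoidPrime {m | var m ∈ P.asIdeal} := by
  refine ⟨fun x hx m => mem_of_support_subset P hx fun p hp => ?_, fun h => ?_,
    fun x y hx hy h => ?_⟩
  · rw [var_apply_eq_zero] at hp ⊢
    exact p.2.1 x hp m
  · refine P.isPrime.ne_top ((Ideal.eq_top_iff_one _).2 (mem_of_support_subset P h fun p hp => ?_))
    exact absurd (var_apply_eq_zero.1 hp) p.2.2.1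
  · refine (P.isPrime.mem_or_mem (x := var x) (y := var y)
      (mem_of_support_subset P h fun p hp => ?_)).elim hx hy
    rw [var_apply_eq_zero] at hp
    by_contra h0
    have h0' : (var x).1 p * (var y).1 p ≠ 0 := h0
    rw [mul_ne_zero_iff, Ne, Ne, var_apply_eq_zero, var_apply_eq_zero] at h0'
    exact p.2.2.2 x y h0'.1 h0'.2 hp

theorem toSpec_surjective : Function.Surjective (toSpec (M := M)) := fun P => by
  let p : KatoSpec M := ⟨_, isMonoidPrime_setOf_var_mem P⟩
  refine ⟨p, ?_⟩
  ext r
  obtain ⟨E, hE⟩ := exists_support_eq r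
  rw [mem_toSpec]
  constructor
  · intro h
    refine mem_of_support_subset P (t := ∑ m ∈ E, var m) (sum_mem fun e he => ?_) fun p hp => ?_
    · by_contra he'
      exact (hE p).2 ⟨e, he, he'⟩ h
    · by_contra hr
      obtain ⟨e, he, hep⟩ := (hE p).1 hr
      exact sum_var_apply_ne_zero he hep hp
  · intro h
    by_contra hr
    obtain ⟨e, he, hep⟩ := (hE p).1 hr
    refine hep (mem_of_support_subset P h fun p hp => var_apply_eq_zero.2 ?_)
    by_contra he'
    exact (hE p).2 ⟨e, he, he'⟩ hp

theorem continuous_toSpec : Continuous (toSpec (M := M)) := by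
  refine PrimeSpectrum.isTopologicalBasis_basic_opens.continuous_iff.2 ?_
  rintro _ ⟨r, rfl⟩
  obtain ⟨E, hE⟩ := exists_support_eq r
  have : toSpec ⁻¹' (PrimeSpectrum.basicOpen r : Set (PrimeSpectrum (katoRing M))) =
      ⋃ e ∈ E, KatoD e := by
    ext p
    simpa [KatoD, mem_toSpec] using hE p
  rw [this]
  exact isOpen_biUnion fun e _ => isOpen_generateFrom_of_mem (mem_range_self e)

theorem isInducing_toSpec : IsInducing (toSpec (M := M)) := by
  refine ⟨le_antisymm continuous_toSpec.le_induced (le_generateFrom ?_)⟩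
  rintro _ ⟨m, rfl⟩
  refine isOpen_induced_iff.2 ⟨_, (PrimeSpectrum.basicOpen (var m)).isOpen, ?_⟩
  ext p
  exact var_apply_eq_zero.not

end katoRing

end KatoRing

/-- the Kato spectrum of a commutative monoid is always homeomorphic to
the Zariski prime spectrum of some commutative ring (i.e. it is a spectral space). -/
theorem stmt19 {M : Type u} [CommMonoid M] :
    ∃ (R : Type u) (_ : CommRing R), Nonempty (KatoSpec M ≃ₜ PrimeSpectrum R) := by
  exact ⟨katoRing M, inferInstance, ⟨(Equiv.ofBijective _ ⟨katoRing.toSpec_injective,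
    katoRing.toSpec_surjective⟩).toHomeomorphOfIsInducing katoRing.isInducing_toSpec⟩⟩
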